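/- arXiv:2102.06931 — 3 statements merged into one kernel-verified Lean document; each statement's English description precedes it below -/
import Mathlib

section
/- Let K be a complex Hilbert space and let A and B be linear relations in K (i.e. ℂ-submodules of K × K), with B closed. Let z ∈ ℂ belong to the resolvent set of B in the sense that (a) for every f ∈ K there exists g ∈ K with (g, f + z•g) ∈ B, and (b) (t, z•t) ∈ B implies t = 0. Then every element (f, f') of A can be written as (f, f') = (g, g') + (t, z•t), where (g, g') ∈ B and (t, z•t) belongs to the relation A ⊔ B (the submodule sum of A and B), and this decomposition is unique (the sum B ∔ R̂_z(A +̂ B) is direct). In other words, A ⊆ B ∔ R̂_z(A +̂ B). -/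
/-- Proposition 2.6 (existence and uniqueness of the decomposition):
`A ⊆ B ∔ R̂_z(A +̂ B)` for `z` in the resolvent set of the closed relation `B`. -/
theorem stmt_0 {K : Type*} [NormedAddCommGroup K] [InnerProductSpace ℂ K] [CompleteSpace K]
    (A B : Submodule ℂ (K × K)) (hB : IsClosed (B : Set (K × K))) (z : ℂ)
    (hres_surj : ∀ f : K, ∃ g : K, (g, f + z • g) ∈ B)
    (hres_inj : ∀ t : K, (t, z • t) ∈ B → t = 0) :
    ∀ f f' : K, (f, f') ∈ A →
      ∃! p : (K × K) × K,
        p.1 ∈ B ∧ (p.2, z • p.2) ∈ A ⊔ B ∧ (f, f') = p.1 + (p.2, z • p.2) := by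
  intro f f' hf
  obtain ⟨g, hg⟩ := hres_surj (f' - z • f)
  have hsum : (f, f') = (g, f' - z • f + z • g) + (f - g, z • (f - g)) := by
    ext
    · simp
    · simp only [Prod.mk_add_mk, smul_sub]
      abel
  refine ⟨((g, f' - z • f + z • g), f - g), ⟨hg, ?_, hsum⟩, ?_⟩
  · rw [← sub_eq_of_eq_add' hsum]
    exact sub_mem (Submodule.mem_sup_left hf) (Submodule.mem_sup_right hg)
  · rintro ⟨b, s⟩ ⟨hb, -, hbs⟩
    have hdiff : (s - (f - g), z • (s - (f - g))) = (g, f' - z • f + z • g) - b := by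
      rw [smul_sub, ← Prod.mk_sub_mk, sub_eq_sub_iff_add_eq_add, add_comm, ← hbs, hsum]
    have hs : s = f - g := sub_eq_zero.mp (hres_inj _ (hdiff ▸ sub_mem hg hb))
    subst hs
    exact Prod.ext (add_right_cancel (hbs.symm.trans hsum)) rfl
end

section
/- Let K be a complex Hilbert space and let A and B be linear relations in K (ℂ-submodules of K × K), with B closed. Let z ∈ ℂ be such that (a) for every f ∈ K there exists g ∈ K with (g, f + z•g) ∈ B, (b) (t, z•t) ∈ B implies t = 0, and (c) (t, z•t) ∈ A implies t = 0 (z is not an eigenvalue of A; this holds when z is in the resolvent set of A). Then A equals the submodule B ⊔ R̂_z(A +̂ B) (i.e. equality holds in the inclusion A ⊆ B ∔ R̂_z(A +̂ B)) if and only if A = B. -/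
/-- Proposition 2.6 (equality case): `A = B ∔ R̂_z(A +̂ B)` if and only if `A = B`. -/
theorem stmt_1 {K : Type*} [NormedAddCommGroup K] [InnerProductSpace ℂ K] [CompleteSpace K]
    (A B : Submodule ℂ (K × K)) (hB : IsClosed (B : Set (K × K))) (z : ℂ)
    (hres_surj : ∀ f : K, ∃ g : K, (g, f + z • g) ∈ B)
    (hres_inj : ∀ t : K, (t, z • t) ∈ B → t = 0)
    (hA_inj : ∀ t : K, (t, z • t) ∈ A → t = 0) :
    A = B ⊔ ((A ⊔ B) ⊓ LinearMap.graph (z • (LinearMap.id : K →ₗ[ℂ] K))) ↔ A = B := by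
  constructor
  · intro h
    have hBA : B ≤ A := le_sup_left.trans h.ge
    have hdefect : (A ⊔ B) ⊓ LinearMap.graph (z • (LinearMap.id : K →ₗ[ℂ] K)) = ⊥ := by
      rw [eq_bot_iff]
      rintro ⟨t, s⟩ ⟨hts, hgraph⟩
      rw [sup_eq_left.mpr hBA] at hts
      obtain rfl : s = z • t := hgraph
      simp [hA_inj t hts]
    rwa [hdefect, sup_bot_eq] at h
  · rintro rfl
    rw [sup_idem, sup_inf_self]
end

section
/- Let H and K be complex Hilbert spaces, J : K → K a fundamental symmetry, Γ : H → K bounded with Γ⁺ := Γ* ∘ J, and A : K → K a bounded operator. Let z ∈ ℂ be such that A − z is invertible and Q(z) := Γ⁺ ∘ (A − z)⁻¹ ∘ Γ is invertible. Then for every f ∈ K, the vector g := (A − z)⁻¹ f − (A − z)⁻¹ Γ (Q(z))⁻¹ Γ⁺ (A − z)⁻¹ f satisfies Γ⁺ g = 0 and f + z•g − A g = Γ ((Q(z))⁻¹ Γ⁺ (A − z)⁻¹ f) ∈ range Γ. (This is the resolvent formula (Â − z)⁻¹ = (A − z)⁻¹ − Γ_z Q(z)⁻¹ Γ_{z̄}⁺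 for the representing relation Â = A|_{(I−P)K} ∔ ({0} × P K) of the inverse function −Q⁻¹, with Γ_z = (A − z)⁻¹ Γ and Γ_{z̄}⁺ = Γ⁺ (A − z)⁻¹.) -/
/-- Lemma 3.4 (resolvent formula): `g := (A − z)⁻¹ f − (A − z)⁻¹ Γ Q(z)⁻¹ Γ⁺ (A − z)⁻¹ f`
satisfies `Γ⁺ g = 0` and `f + z g − A g = Γ (Q(z)⁻¹ Γ⁺ (A − z)⁻¹ f)`. -/
theorem stmt_8 {H K : Type*} [NormedAddCommGroup H] [InnerProductSpace ℂ H] [CompleteSpace H]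
    [NormedAddCommGroup K] [InnerProductSpace ℂ K] [CompleteSpace K]
    (J : K →L[ℂ] K) (hJsa : IsSelfAdjoint J) (hJ2 : J ∘L J = 1)
    (Γ : H →L[ℂ] K) (Γp : K →L[ℂ] H) (hΓp : Γp = ContinuousLinearMap.adjoint Γ ∘L J)
    (A : K →L[ℂ] K) (z : ℂ) (Rz : K →L[ℂ] K)
    (hR1 : (A - z • 1) ∘L Rz = 1) (hR2 : Rz ∘L (A - z • 1) = 1)
    (Qinv : H →L[ℂ] H)
    (hQ1 : Qinv ∘L (Γp ∘L Rz ∘L Γ) = 1) (hQ2 : (Γp ∘L Rz ∘L Γ) ∘L Qinv = 1) :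
    ∀ f : K,
      Γp (Rz f - Rz (Γ (Qinv (Γp (Rz f))))) = 0 ∧
      f + z • (Rz f - Rz (Γ (Qinv (Γp (Rz f))))) - A (Rz f - Rz (Γ (Qinv (Γp (Rz f))))) =
        Γ (Qinv (Γp (Rz f))) := by
  intro f
  have hR (x : K) : A (Rz x) = x + z • Rz x := by
    have h := DFunLike.congr_fun hR1 x
    simpa [sub_eq_iff_eq_add] using h
  have hQ (y : H) : Γp (Rz (Γ (Qinv y))) = y := DFunLike.congr_fun hQ2 y
  refine ⟨by rw [map_sub, hQ, sub_self], ?_⟩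
  rw [map_sub, hR, hR, smul_sub]
  abel
end
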